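/- arXiv:2411.18297 — 2 statements merged into one kernel-verified Lean document; each statement's English description precedes it below -/
import Mathlib

section
/- Every parabolic IFS Φ = {φ_i}_{i∈I} on [0,1] has decay of fundamental intervals: for every ω ∈ I^ℕ, the nested intersection ⋂_{n=1}^∞ φ_{ω₁⋯ω_n}([0,1]) is a singleton. -/
open Set MeasureTheory Filter Topology

open scoped ENNReal NNReal Classical

namespace ParabolicIFSPaper

noncomputable section

/-- Composition `φ_{ω₁} ∘ ⋯ ∘ φ_{ω_n}` for a (0-indexed) sequence of digits `ω`. -/
def comp (φ : ℕ → ℝ → ℝ) (ω : ℕ → ℕ) : ℕ → ℝ → ℝ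
  | 0 => id
  | n + 1 => comp φ ω n ∘ φ (ω n)

/-- Composition `φ_{a₁} ∘ ⋯ ∘ φ_{a_n}` along a finite word given as a list. -/
def wcomp (φ : ℕ → ℝ → ℝ) : List ℕ → ℝ → ℝ
  | [] => id
  | a :: l => φ a ∘ wcomp φ l

/-- A parabolic Iterated Function System on `[0,1]`:  an index set `I ⊆ ℕ` with at least two
elements, `C¹` maps `φ i : [0,1] → [0,1]`, the open set condition, the non-uniform contraction
condition (A1) with finitely many parabolic pairs, and the bounded distortion condition (A2). -/
structure PIFS where
  I : Set ℕ
  I_nontrivial : I.Nontrivial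
  φ : ℕ → ℝ → ℝ
  smooth : ∀ i ∈ I, ContDiff ℝ 1 (φ i)
  maps_to : ∀ i ∈ I, MapsTo (φ i) (Icc (0:ℝ) 1) (Icc (0:ℝ) 1)
  osc : ∀ i ∈ I, ∀ j ∈ I, i ≠ j → φ i '' Ioo (0:ℝ) 1 ∩ φ j '' Ioo (0:ℝ) 1 = ∅
  Par : Set ℕ
  Par_sub : Par ⊆ I
  Par_finite : Par.Finite
  fixpt : ℕ → ℝ
  fixpt_mem : ∀ i ∈ Par, fixpt i ∈ Icc (0:ℝ) 1
  fixpt_fixed : ∀ i ∈ Par, φ i (fixpt i) = fixpt i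
  fixpt_unique : ∀ i ∈ Par, ∀ x ∈ Icc (0:ℝ) 1, φ i x = x → x = fixpt i
  deriv_one : ∀ i ∈ Par, |deriv (φ i) (fixpt i)| = 1
  contracting : ∀ i ∈ I, ∀ x ∈ Icc (0:ℝ) 1, (i ∉ Par ∨ x ≠ fixpt i) → |deriv (φ i) x| < 1
  distC : ℝ
  distC_ge_one : 1 ≤ distC
  distortion : ∀ ω : ℕ → ℕ, (∀ k, ω k ∈ I) → ∀ n, 2 ≤ n →
    (ω (n - 1) ∉ Par ∨ ω (n - 2) ≠ ω (n - 1)) →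
    ∀ x ∈ Icc (0:ℝ) 1, ∀ y ∈ Icc (0:ℝ) 1,
      |deriv (comp φ ω n) x| ≤ distC * |deriv (comp φ ω n) y|

/-- The set of admissible digit sequences `I^ℕ`. -/
def PIFS.Seqs (Φ : PIFS) : Set (ℕ → ℕ) := {ω | ∀ k, ω k ∈ Φ.I}

/-- The set of admissible words of length `n`, i.e. `I^n`. -/
def Words (Φ : PIFS) (n : ℕ) : Set (List ℕ) := {l | l.length = n ∧ ∀ a ∈ l, a ∈ Φ.I}

/-- The fundamental interval `J(ω) = φ_ω([0,1])` of a finite word. -/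
def Jset (Φ : PIFS) (l : List ℕ) : Set ℝ := wcomp Φ.φ l '' Icc (0:ℝ) 1

/-- `Pi` is an address map for `Φ` if `Pi ω` lies in every fundamental interval
`φ_{ω₁⋯ω_n}([0,1])`; since these intersections are singletons for a parabolic IFS, this
characterizes the address map. -/
def IsAddressMap (Φ : PIFS) (Pi : (ℕ → ℕ) → ℝ) : Prop :=
  ∀ ω ∈ Φ.Seqs, ∀ n : ℕ, Pi ω ∈ comp Φ.φ ω n '' Icc (0:ℝ) 1

/-- The limit set `Λ(Φ) = Π(I^ℕ)`. -/
def limitSet (Φ : PIFS) (Pi : (ℕ → ℕ) → ℝ) : Set ℝ := Pi '' Φ.Seqs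

/-- The set `Λ_*(Φ)` of points having exactly one address. -/
def uniqueCoded (Φ : PIFS) (Pi : (ℕ → ℕ) → ℝ) : Set ℝ :=
  {x | ∃! ω : ℕ → ℕ, ω ∈ Φ.Seqs ∧ Pi ω = x}

/-- `max{a₁(x),…,a_n(x)} ⋅ (log log n) / n` for the digit sequence `ω`. -/
def ratio (ω : ℕ → ℕ) (n : ℕ) : ℝ :=
  ((((Finset.range n).sup ω : ℕ) : ℝ)) * Real.log (Real.log n) / n

/-- The level set `L(α)` of points whose largest-digit growth rate is `α ∈ [0,∞]`. -/
def levelSet (Φ : PIFS) (Pi : (ℕ → ℕ) → ℝ) (α : EReal) : Set ℝ :=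
  {x ∈ uniqueCoded Φ Pi |
    ∀ ω ∈ Φ.Seqs, Pi ω = x → Tendsto (fun n => (ratio ω n : EReal)) atTop (𝓝 α)}

/-- `Φ` is `d`-decaying: `min_x |φ_i'(x)| ≥ c / i^d`. -/
def Decaying (Φ : PIFS) (d : ℝ) : Prop :=
  ∃ c : ℝ, 0 < c ∧ ∀ i ∈ Φ.I, ∀ x ∈ Icc (0:ℝ) 1, c / (i : ℝ) ^ d ≤ |deriv (Φ.φ i) x|

/-- The shift map on sequence space. -/
def shift : (ℕ → ℕ) → (ℕ → ℕ) := fun ω n => ω (n + 1)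

/-- The Lyapunov exponent `χ(ν) = -∫ log |φ'_{ω₁}(Π ω)| dν(ω)` (in `[0,∞]`). -/
def lyap (Φ : PIFS) (Pi : (ℕ → ℕ) → ℝ) (ν : Measure (ℕ → ℕ)) : ℝ≥0∞ :=
  ∫⁻ ω, ENNReal.ofReal (- Real.log |deriv (Φ.φ (ω 0)) (Pi ω)|) ∂ν

/-- The class `𝓜(Φ)` of shift-invariant ergodic probability measures carried by `I^ℕ`
with finite Lyapunov exponent. -/
def MeasClass (Φ : PIFS) (Pi : (ℕ → ℕ) → ℝ) : Set (Measure (ℕ → ℕ)) :=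
  {ν | IsProbabilityMeasure ν ∧ ν Φ.Seqs = 1 ∧ Ergodic shift ν ∧ lyap Φ Pi ν < ⊤}

/-- `dim(μ) = inf {dim_H A : A ⊆ [0,1], μ(A) = 1}`. -/
def mdim (μ : Measure ℝ) : ℝ≥0∞ :=
  ⨅ (A : Set ℝ) (_ : A ⊆ Icc (0:ℝ) 1) (_ : μ A = 1), dimH A

/-- Condition (B1) (saturation). -/
def SatB1 (Φ : PIFS) (Pi : (ℕ → ℕ) → ℝ) : Prop :=
  dimH (limitSet Φ Pi) = ⨆ ν ∈ MeasClass Φ Pi, mdim (Measure.map Pi ν)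

/-- Condition (B2) (mild distortion): `D₁(Φ) < ∞` and `D_n(Φ) = o(n)`. -/
def MildB2 (Φ : PIFS) : Prop :=
  (∃ C : ℝ, ∀ i ∈ Φ.I, ∀ x ∈ Icc (0:ℝ) 1, ∀ y ∈ Icc (0:ℝ) 1,
    |deriv (Φ.φ i) x| ≤ C * |deriv (Φ.φ i) y|) ∧
  ∀ ε : ℝ, 0 < ε → ∃ N : ℕ, ∀ n, N ≤ n → ∀ l ∈ Words Φ n,
    ∀ x ∈ Icc (0:ℝ) 1, ∀ y ∈ Icc (0:ℝ) 1,
      |deriv (wcomp Φ.φ l) x| ≤ Real.exp (ε * n) * |deriv (wcomp Φ.φ l) y|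

/-- Composition along a sequence of finite words:
`φ_{σ₀} ∘ φ_{σ₁} ∘ ⋯ ∘ φ_{σ_{n-1}}`. -/
def seqComp (φ : ℕ → ℝ → ℝ) (σ : ℕ → List ℕ) : ℕ → ℝ → ℝ
  | 0 => id
  | n + 1 => seqComp φ σ n ∘ wcomp φ (σ n)

/-- The limit set of the finite IFS `{φ_w}_{w ∈ W}` indexed by words. -/
def finLimitSet (φ : ℕ → ℝ → ℝ) (W : Set (List ℕ)) : Set ℝ :=
  {x | ∃ σ : ℕ → List ℕ, (∀ k, σ k ∈ W) ∧ ∀ n, x ∈ seqComp φ σ n '' Icc (0:ℝ) 1}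

/-- `τ(x) = x / log log x`. -/
def tau (x : ℝ) : ℝ := x / Real.log (Real.log x)

/-- Number of insertion positions among `1,…,j`. -/
def cnt (nseq : ℕ → ℕ) (j : ℕ) : ℕ :=
  ((Finset.range (j + 1)).filter fun k => 1 ≤ k ∧ nseq k ≤ j).card

/-- Insertion of the digits `⌊α τ(n(k))⌋` at the positions `n(k)`, `k ≥ 1`, into the
(0-indexed) digit sequence `b`; index `m` corresponds to the (1-indexed) position `m + 1`. -/
def insertSeq (nseq : ℕ → ℕ) (α : ℝ) (b : ℕ → ℕ) : ℕ → ℕ := fun m =>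
  if ∃ k, 1 ≤ k ∧ nseq k = m + 1 then ⌊α * tau (m + 1)⌋₊
  else b (m - cnt nseq (m + 1))

/-- The digit sequence obtained by concatenating the words `σ 0, σ 1, …`, each of length `p`. -/
def flattenSeq (p : ℕ) (σ : ℕ → List ℕ) : ℕ → ℕ := fun m => (σ (m / p)).getD (m % p) 0

/-- The set `L_p(α)` of points obtained from points of `Λ(Φ_p)` by inserting the digits
`⌊α τ(n(k))⌋` at the positions `n(k)`. -/
def LpSet (Φ : PIFS) (Pi : (ℕ → ℕ) → ℝ) (W : Set (List ℕ)) (p : ℕ)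
    (nseq : ℕ → ℕ) (α : ℝ) : Set ℝ :=
  {x | ∃ σ : ℕ → List ℕ, (∀ k, σ k ∈ W) ∧ x = Pi (insertSeq nseq α (flattenSeq p σ))}

/-- The set `A_k` of admissible words `a₁ ⋯ a_{n(k+1)}` (0-indexed: `a 0 = a₁`):
each block between consecutive insertion positions is a concatenation of words of `W`,
and the digit at each insertion position `n(j+1)` is `⌊α τ(n(j+1))⌋`. -/
def Aset (Φ : PIFS) (W : Set (List ℕ)) (p : ℕ) (nseq mseq : ℕ → ℕ) (α : ℝ) (k : ℕ) :
    Set (ℕ → ℕ) :=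
  {a | (∀ i < nseq (k + 1), a i ∈ Φ.I) ∧
    ∀ j ≤ k,
      (∀ i < mseq j, ∃ w ∈ W, ∀ r < p, a (nseq j + i * p + r) = w.getD r 0) ∧
      a (nseq (j + 1) - 1) = ⌊α * tau (nseq (j + 1))⌋₊}

/-- `B_k = {n(k) + m p : m = 0,…,m(k)}`. -/
def Bset (nseq mseq : ℕ → ℕ) (p k : ℕ) : Set ℕ :=
  {n | ∃ m ≤ mseq k, n = nseq k + m * p}

/-- The composition `φ_{ā₁⋯ā_n}` along the word obtained from `a₁ ⋯ a_n` by eliminating the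
digits at the insertion positions `n(1), n(2), …` (0-indexed: index `n` ↔ position `n + 1`). -/
def elimComp (φ : ℕ → ℝ → ℝ) (nseq : ℕ → ℕ) (a : ℕ → ℕ) : ℕ → ℝ → ℝ
  | 0 => id
  | n + 1 =>
    if ∃ k, 1 ≤ k ∧ nseq k = n + 1 then elimComp φ nseq a n
    else elimComp φ nseq a n ∘ φ (a n)

/-- The minimal distance `K` between distinct fundamental intervals `J(w)`, `w ∈ W`. -/
def Kdist (Φ : PIFS) (W : Set (List ℕ)) : ℝ :=
  sInf {r | ∃ w ∈ W, ∃ w' ∈ W, w ≠ w' ∧ ∃ u ∈ Jset Φ w, ∃ v ∈ Jset Φ w', r = |u - v|}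

/-- The data of the insertion construction of Section 3 of the paper: a `d`-decaying
parabolic IFS `Φ` with address map `Pi` satisfying (B1) and (B2), `ε > 0`, an integer `p ≥ 2`
with `(k+p+1)^d + 2p + 1 < (k+p+2)^d`, a finite set `W ⊆ I^p` of words with pairwise disjoint
fundamental intervals, non-parabolic last letters, uniform contraction rate `e^{-γp}` and
limit set of dimension `> dim_H Λ(Φ) - ε`, the insertion positions `n(k)` (with the block
lengths `m(k)`), and `α ∈ (0,∞)`, the inserted digits `⌊α τ(n(k))⌋` belonging to `I`. -/
structure InsSetup (Φ : PIFS) (Pi : (ℕ → ℕ) → ℝ) where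
  d : ℝ
  hd : 1 < d
  hdec : Decaying Φ d
  hPi : IsAddressMap Φ Pi
  hPiMeas : Measurable Pi
  hB1 : SatB1 Φ Pi
  hB2 : MildB2 Φ
  ε : ℝ
  hε : 0 < ε
  p : ℕ
  hp2 : 2 ≤ p
  hpd : ∀ k : ℕ, ((k : ℝ) + p + 1) ^ d + 2 * p + 1 < ((k : ℝ) + p + 2) ^ d
  W : Finset (List ℕ)
  hWne : W.Nonempty
  hWsub : (↑W : Set (List ℕ)) ⊆ Words Φ p
  hWdisj : ∀ w ∈ W, ∀ w' ∈ W, w ≠ w' → Jset Φ w ∩ Jset Φ w' = ∅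
  hWlast : ∀ w ∈ W, ∀ h : w ≠ [], w.getLast h ∉ Φ.Par
  γ : ℝ
  hγ : 0 < γ
  hWcontr : ∀ w ∈ W, ∀ x ∈ Icc (0:ℝ) 1, |deriv (wcomp Φ.φ w) x| < Real.exp (-(γ * p))
  hWdim : dimH (limitSet Φ Pi) - ENNReal.ofReal ε < dimH (finLimitSet Φ.φ (↑W : Set (List ℕ)))
  α : ℝ
  hα : 0 < α
  nseq : ℕ → ℕ
  mseq : ℕ → ℕ
  hn0 : nseq 0 = 0
  hm2 : ∀ k, 2 ≤ mseq k
  hmlow : ∀ k : ℕ, (nseq k : ℝ) + ((mseq k : ℝ) - 1) * p ≤ ((k : ℝ) + p + 1) ^ d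
  hmhigh : ∀ k : ℕ, ((k : ℝ) + p + 1) ^ d < (nseq k : ℝ) + (mseq k : ℝ) * p
  hnrec : ∀ k, nseq (k + 1) = nseq k + mseq k * p + 1
  hins : ∀ k, 1 ≤ k → ⌊α * tau (nseq k)⌋₊ ∈ Φ.I

theorem image_iInter_of_antitone_isCompact {f : ℝ → ℝ} (hf : Continuous f) {K : ℕ → Set ℝ}
    (hanti : Antitone K) (hK : ∀ n, IsCompact (K n)) :
    f '' ⋂ n, K n = ⋂ n, f '' K n := by
  refine (image_iInter_subset K f).antisymm fun y hy => ?_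
  have hcl : IsClosed (f ⁻¹' {y}) := isClosed_singleton.preimage hf
  obtain ⟨x, hx⟩ := IsCompact.nonempty_iInter_of_sequence_nonempty_isCompact_isClosed
    (fun n => K n ∩ f ⁻¹' {y})
    (fun n => inter_subset_inter_left _ (hanti n.le_succ))
    (fun n => by
      obtain ⟨x, hx, hxy⟩ := mem_iInter.1 hy n
      exact ⟨x, hx, hxy⟩)
    ((hK 0).inter_right hcl) (fun n => (hK n).isClosed.inter hcl)
  rw [mem_iInter] at hx
  exact ⟨x, mem_iInter.2 fun n => (hx n).1, (hx 0).2⟩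

theorem subsingleton_of_image_eq {f : ℝ → ℝ} {K : Set ℝ} (hK : IsCompact K)
    (hfK : f '' K = K) (hf : ∀ x ∈ K, ∀ y ∈ K, x ≠ y → |f x - f y| < |x - y|) :
    K.Subsingleton := by
  intro x hx y hy
  obtain ⟨⟨a, b⟩, ⟨ha, hb⟩, hmax⟩ := (hK.prod hK).exists_isMaxOn ⟨(x, y), hx, hy⟩
    (f := fun p : ℝ × ℝ => |p.1 - p.2|) (by fun_prop)
  obtain ⟨a', ha', rfl⟩ : a ∈ f '' K := hfK.symm ▸ ha
  obtain ⟨b', hb', rfl⟩ : b ∈ f '' K := hfK.symm ▸ hb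
  have hxy : |x - y| ≤ |f a' - f b'| := hmax (show (x, y) ∈ K ×ˢ K from ⟨hx, hy⟩)
  have hab : |a' - b'| ≤ |f a' - f b'| := hmax (show (a', b') ∈ K ×ˢ K from ⟨ha', hb'⟩)
  have heq : a' = b' := by
    by_contra h
    exact (hf a' ha' b' hb' h).not_ge hab
  rw [heq, sub_self, abs_zero] at hxy
  exact sub_eq_zero.1 (abs_nonpos_iff.1 hxy)

/-- If `|f'| ≥ κ > 0` on `[0,1]`, then passing from `[0,1]` to a compact subset `K` shortens the
image by at least `κ` times the amount by which it shortens the domain. -/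
theorem diam_image_add_le {f : ℝ → ℝ} (hf : Differentiable ℝ f) {κ : ℝ} (hκ : 0 < κ)
    (hd : ∀ x ∈ Icc (0:ℝ) 1, κ ≤ |deriv f x|) {K : Set ℝ} (hK : IsCompact K)
    (hne : K.Nonempty) (hK01 : K ⊆ Icc 0 1) :
    Metric.diam (f '' K) + κ * (1 - Metric.diam K) ≤ Metric.diam (f '' Icc 0 1) := by
  have hexp : ∀ u ∈ Icc (0:ℝ) 1, ∀ v ∈ Icc (0:ℝ) 1, u ≤ v → κ * (v - u) ≤ |f v - f u| := by
    intro u hu v hv huv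
    rcases huv.eq_or_lt with rfl | huv
    · simp
    obtain ⟨c, hc, hcd⟩ := exists_deriv_eq_slope f huv hf.continuous.continuousOn
      hf.differentiableOn
    have hvu : 0 < v - u := sub_pos.2 huv
    have hle := hd c ⟨hu.1.trans hc.1.le, hc.2.le.trans hv.2⟩
    rw [hcd, abs_div, abs_of_pos hvu, le_div_iff₀ hvu] at hle
    exact hle
  have hinj : InjOn f (Icc 0 1) := by
    have key : ∀ u ∈ Icc (0:ℝ) 1, ∀ v ∈ Icc (0:ℝ) 1, f u = f v → ¬ u < v := by
      intro u hu v hv huv hlt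
      have := hexp u hu v hv hlt.le
      rw [huv, sub_self, abs_zero] at this
      exact this.not_gt (mul_pos hκ (sub_pos.2 hlt))
    exact fun u hu v hv huv => le_antisymm (not_lt.1 (key v hv u hu huv.symm))
      (not_lt.1 (key u hu v hv huv))
  have hbd : Bornology.IsBounded (f '' Icc 0 1) :=
    (isCompact_Icc.image hf.continuous).isBounded
  have h0 : (0:ℝ) ∈ Icc (0:ℝ) 1 := by simp
  have h1 : (1:ℝ) ∈ Icc (0:ℝ) 1 := by simp
  have htot : |f 1 - f 0| ≤ Metric.diam (f '' Icc 0 1) :=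
    Metric.dist_le_diam_of_mem hbd (mem_image_of_mem f h1) (mem_image_of_mem f h0)
  have key : ∀ p ∈ K, ∀ q ∈ K, p ≤ q →
      |f q - f p| + κ * (1 - Metric.diam K) ≤ Metric.diam (f '' Icc 0 1) := by
    intro p hp q hq hpq
    refine le_trans ?_ htot
    have hp' := hK01 hp
    have hq' := hK01 hq
    have hqp : q - p ≤ Metric.diam K :=
      (le_abs_self _).trans (Metric.dist_le_diam_of_mem hK.isBounded hq hp)
    have e0 := hexp 0 h0 p hp' hp'.1
    have e1 := hexp q hq' 1 h1 hq'.2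
    have e2 := mul_le_mul_of_nonneg_left hqp hκ.le
    rcases ContinuousOn.strictMonoOn_of_injOn_Icc' zero_le_one hf.continuous.continuousOn hinj
      with hm | hm
    · have m0 := hm.monotoneOn h0 hp' hp'.1
      have m1 := hm.monotoneOn hq' h1 hq'.2
      have m2 := hm.monotoneOn hp' hq' hpq
      rw [abs_of_nonneg (by linarith)] at e0 e1 ⊢
      rw [abs_of_nonneg (by linarith)]
      linarith
    · have m0 := hm.antitoneOn h0 hp' hp'.1
      have m1 := hm.antitoneOn hq' h1 hq'.2
      have m2 := hm.antitoneOn hp' hq' hpq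
      rw [abs_of_nonpos (by linarith)] at e0 e1 ⊢
      rw [abs_of_nonpos (by linarith)]
      linarith
  rw [← le_sub_iff_add_le]
  obtain ⟨p₀, hp₀⟩ := hne
  refine Metric.diam_le_of_forall_dist_le_of_nonempty ⟨f p₀, mem_image_of_mem f hp₀⟩ ?_
  rintro _ ⟨p, hp, rfl⟩ _ ⟨q, hq, rfl⟩
  rw [le_sub_iff_add_le, Real.dist_eq]
  rcases le_total p q with h | h
  · rw [abs_sub_comm]
    exact key p hp q hq h
  · exact key q hq p hp h

theorem comp_add (φ : ℕ → ℝ → ℝ) (ω : ℕ → ℕ) (n k : ℕ) :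
    comp φ ω (n + k) = comp φ ω n ∘ comp φ (fun j => ω (n + j)) k := by
  induction k with
  | zero => rfl
  | succ k ih =>
    rw [← add_assoc, comp, comp, ih]
    rfl

theorem mapsTo_comp {Φ : PIFS} {ω : ℕ → ℕ} (hω : ω ∈ Φ.Seqs) (n : ℕ) :
    MapsTo (comp Φ.φ ω n) (Icc 0 1) (Icc 0 1) := by
  induction n with
  | zero => exact mapsTo_id _
  | succ n ih => exact ih.comp (Φ.maps_to _ (hω n))

theorem differentiable_comp {Φ : PIFS} {ω : ℕ → ℕ} (hω : ω ∈ Φ.Seqs) (n : ℕ) :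
    Differentiable ℝ (comp Φ.φ ω n) := by
  induction n with
  | zero => exact differentiable_id
  | succ n ih => exact ih.comp ((Φ.smooth _ (hω n)).differentiable one_ne_zero)

theorem isCompact_image_comp {Φ : PIFS} {ω : ℕ → ℕ} (hω : ω ∈ Φ.Seqs) (n : ℕ) :
    IsCompact (comp Φ.φ ω n '' Icc 0 1) :=
  isCompact_Icc.image (differentiable_comp hω n).continuous

theorem antitone_image_comp {Φ : PIFS} {ω : ℕ → ℕ} (hω : ω ∈ Φ.Seqs) :
    Antitone fun n => comp Φ.φ ω n '' Icc (0:ℝ) 1 := by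
  refine antitone_nat_of_succ_le fun n => ?_
  rw [comp, image_comp]
  exact image_mono (Φ.maps_to _ (hω n)).image_subset

theorem nonempty_iInter_image_comp {Φ : PIFS} {ω : ℕ → ℕ} (hω : ω ∈ Φ.Seqs) :
    (⋂ n, comp Φ.φ ω n '' Icc (0:ℝ) 1).Nonempty :=
  IsCompact.nonempty_iInter_of_sequence_nonempty_isCompact_isClosed _
    (fun n => antitone_image_comp hω n.le_succ) (fun _ => (nonempty_Icc.2 zero_le_one).image _)
    (isCompact_image_comp hω 0) (fun n => (isCompact_image_comp hω n).isClosed)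

theorem abs_sub_lt_of_mem {Φ : PIFS} {i : ℕ} (hi : i ∈ Φ.I) {x y : ℝ} (hx : x ∈ Icc (0:ℝ) 1)
    (hy : y ∈ Icc (0:ℝ) 1) (hxy : x ≠ y) : |Φ.φ i x - Φ.φ i y| < |x - y| := by
  wlog hlt : x < y generalizing x y
  · rw [abs_sub_comm, abs_sub_comm x]
    exact this hy hx hxy.symm (lt_of_le_of_ne (not_lt.1 hlt) hxy.symm)
  have hd := (Φ.smooth i hi).differentiable one_ne_zero
  have key : ∀ u ∈ Icc (0:ℝ) 1, ∀ v ∈ Icc (0:ℝ) 1, u < v → (i ∈ Φ.Par → Φ.fixpt i ∉ Ioo u v) →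
      |Φ.φ i u - Φ.φ i v| < v - u := by
    intro u hu v hv huv hfix
    obtain ⟨c, hc, hcd⟩ := exists_deriv_eq_slope (Φ.φ i) huv hd.continuous.continuousOn
      hd.differentiableOn
    have hvu : 0 < v - u := sub_pos.2 huv
    have hlt := Φ.contracting i hi c ⟨hu.1.trans hc.1.le, hc.2.le.trans hv.2⟩
      (or_iff_not_imp_left.2 fun h hcfix => hfix (not_not.1 h) (hcfix ▸ hc))
    rwa [hcd, abs_div, abs_of_pos hvu, div_lt_one hvu, abs_sub_comm] at hlt
  rw [abs_sub_comm x, abs_of_pos (sub_pos.2 hlt)]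
  by_cases h : Φ.fixpt i ∈ Ioo x y
  · have hp : Φ.fixpt i ∈ Icc (0:ℝ) 1 := ⟨hx.1.trans h.1.le, h.2.le.trans hy.2⟩
    have h1 := key x hx _ hp h.1 fun _ hm => lt_irrefl _ hm.2
    have h2 := key _ hp y hy h.2 fun _ hm => lt_irrefl _ hm.1
    have h3 := abs_sub_le (Φ.φ i x) (Φ.φ i (Φ.fixpt i)) (Φ.φ i y)
    linarith
  · exact key x hx y hy hlt fun _ => h

theorem abs_comp_sub_le {Φ : PIFS} {ω : ℕ → ℕ} (hω : ω ∈ Φ.Seqs) (n : ℕ) {x y : ℝ}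
    (hx : x ∈ Icc (0:ℝ) 1) (hy : y ∈ Icc (0:ℝ) 1) :
    |comp Φ.φ ω n x - comp Φ.φ ω n y| ≤ |x - y| := by
  induction n generalizing x y with
  | zero => exact le_rfl
  | succ n ih =>
    refine (ih (Φ.maps_to _ (hω n) hx) (Φ.maps_to _ (hω n) hy)).trans ?_
    rcases eq_or_ne x y with rfl | hxy
    · simp
    · exact (abs_sub_lt_of_mem (hω n) hx hy hxy).le

theorem half_mem_image_Ioo {Φ : PIFS} {i : ℕ} (hi : i ∈ Φ.I)
    (h : 1 / 2 < Metric.diam (Φ.φ i '' Icc 0 1)) : (1 / 2 : ℝ) ∈ Φ.φ i '' Ioo (0:ℝ) 1 := by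
  have hcont := (Φ.smooth i hi).continuous
  have hsub : Φ.φ i '' Icc 0 1 ⊆ closure (Φ.φ i '' Ioo (0:ℝ) 1) := by
    rw [← closure_Ioo (zero_ne_one' ℝ)]
    exact image_closure_subset_closure_image hcont
  have hmaps : ∀ x ∈ Φ.φ i '' Ioo (0:ℝ) 1, x ∈ Icc (0:ℝ) 1 := by
    rintro _ ⟨x, hx, rfl⟩
    exact Φ.maps_to i hi (Ioo_subset_Icc_self hx)
  have hbd : Bornology.IsBounded (Φ.φ i '' Ioo (0:ℝ) 1) := (Metric.isBounded_Icc 0 1).subset hmaps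
  have hdiam : 1 / 2 < Metric.diam (Φ.φ i '' Ioo (0:ℝ) 1) := by
    rw [← Metric.diam_closure]
    exact h.trans_le (Metric.diam_mono hsub hbd.closure)
  have hord : (Φ.φ i '' Ioo (0:ℝ) 1).OrdConnected :=
    (isPreconnected_Ioo.image _ hcont.continuousOn).ordConnected
  by_contra hhalf
  refine hdiam.not_ge (Metric.diam_le_of_forall_dist_le (by norm_num) ?_)
  have key : ∀ a ∈ Φ.φ i '' Ioo (0:ℝ) 1, ∀ b ∈ Φ.φ i '' Ioo (0:ℝ) 1, b - a ≤ 1 / 2 := by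
    intro a ha b hb
    by_contra! hab
    have ha' := hmaps a ha
    have hb' := hmaps b hb
    exact hhalf (hord.out ha hb ⟨by linarith [hb'.2], by linarith [ha'.1]⟩)
  exact fun a ha b hb => abs_sub_le_iff.2 ⟨key b hb a ha, key a ha b hb⟩

theorem eq_of_half_lt_diam {Φ : PIFS} {i j : ℕ} (hi : i ∈ Φ.I) (hj : j ∈ Φ.I)
    (h : 1 / 2 < Metric.diam (Φ.φ i '' Icc 0 1)) (h' : 1 / 2 < Metric.diam (Φ.φ j '' Icc 0 1)) :
    i = j := by
  by_contra hij
  exact (Φ.osc i hi j hj hij).le ⟨half_mem_image_Ioo hi h, half_mem_image_Ioo hj h'⟩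

theorem diam_image_comp_le {Φ : PIFS} {ω : ℕ → ℕ} (hω : ω ∈ Φ.Seqs) (n : ℕ) :
    Metric.diam (comp Φ.φ ω (n + 1) '' Icc 0 1) ≤ Metric.diam (Φ.φ (ω n) '' Icc 0 1) := by
  have hmaps := Φ.maps_to _ (hω n)
  have hbd : Bornology.IsBounded (Φ.φ (ω n) '' Icc 0 1) :=
    (Metric.isBounded_Icc 0 1).subset hmaps.image_subset
  refine Metric.diam_le_of_forall_dist_le Metric.diam_nonneg ?_
  rintro _ ⟨x, hx, rfl⟩ _ ⟨y, hy, rfl⟩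
  exact (abs_comp_sub_le hω n (hmaps hx) (hmaps hy)).trans
    (Metric.dist_le_diam_of_mem hbd (mem_image_of_mem _ hx) (mem_image_of_mem _ hy))

theorem subsingleton_iInter_of_const {Φ : PIFS} {i : ℕ} (hi : i ∈ Φ.I) :
    (⋂ n, comp Φ.φ (fun _ => i) n '' Icc (0:ℝ) 1).Subsingleton := by
  have hω : (fun _ => i) ∈ Φ.Seqs := fun _ => hi
  have hanti := antitone_image_comp hω
  refine subsingleton_of_image_eq (f := Φ.φ i)
    ((isCompact_image_comp hω 0).of_isClosed_subset
      (isClosed_iInter fun n => (isCompact_image_comp hω n).isClosed) (iInter_subset _ 0)) ?_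
    fun x hx y hy => abs_sub_lt_of_mem hi ?_ ?_
  · have hshift : ∀ n, Φ.φ i '' (comp Φ.φ (fun _ => i) n '' Icc 0 1) =
        comp Φ.φ (fun _ => i) (n + 1) '' Icc 0 1 := by
      intro n
      rw [← image_comp, add_comm, comp_add]
      rfl
    rw [image_iInter_of_antitone_isCompact (Φ.smooth i hi).continuous hanti
      (isCompact_image_comp hω), iInter_congr hshift]
    exact hanti.iInf_nat_add 1
  · simpa [comp] using mem_iInter.1 hx 0
  · simpa [comp] using mem_iInter.1 hy 0

theorem subsingleton_iInter_of_eventually_const {Φ : PIFS} {ω : ℕ → ℕ} (hω : ω ∈ Φ.Seqs)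
    {N i : ℕ} (hN : ∀ n, N ≤ n → ω n = i) :
    (⋂ n, comp Φ.φ ω n '' Icc (0:ℝ) 1).Subsingleton := by
  have hi : i ∈ Φ.I := hN N le_rfl ▸ hω N
  have hc : (fun _ => i) ∈ Φ.Seqs := fun _ => hi
  have htail : (fun j => ω (N + j)) = fun _ => i := funext fun j => hN _ (Nat.le_add_right _ _)
  refine ((subsingleton_iInter_of_const hi).image (comp Φ.φ ω N)).anti ?_
  rw [image_iInter_of_antitone_isCompact (differentiable_comp hω N).continuous
    (antitone_image_comp hc) (isCompact_image_comp hc)]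
  refine subset_iInter fun n => (iInter_subset _ (N + n)).trans ?_
  rw [comp_add, htail, image_comp]

/-- If the fundamental intervals of `ω` do not shrink to a point, their lengths are nearly
constant from some time of bounded distortion on, so every later map has image longer than
`1 / 2`, and the open set condition leaves only one choice for it. -/
theorem eventually_const_of_frequently {Φ : PIFS} {ω : ℕ → ℕ} (hω : ω ∈ Φ.Seqs) {x y : ℝ}
    (hx : x ∈ ⋂ n, comp Φ.φ ω n '' Icc (0:ℝ) 1) (hy : y ∈ ⋂ n, comp Φ.φ ω n '' Icc (0:ℝ) 1)
    (hxy : x ≠ y)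
    (hfreq : ∀ N, ∃ n, N ≤ n ∧ 2 ≤ n ∧ (ω (n - 1) ∉ Φ.Par ∨ ω (n - 2) ≠ ω (n - 1))) :
    ∃ N i, ∀ n, N ≤ n → ω n = i := by
  set J : ℕ → Set ℝ := fun n => comp Φ.φ ω n '' Icc 0 1 with hJ
  have hcpt : ∀ n, IsCompact (J n) := isCompact_image_comp hω
  have hanti : Antitone fun n => Metric.diam (J n) := fun m n hmn =>
    Metric.diam_mono (antitone_image_comp hω hmn) (hcpt m).isBounded
  have hC : 0 < Φ.distC := zero_lt_one.trans_le Φ.distC_ge_one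
  set κ : ℝ := |x - y| / Φ.distC with hκdef
  have hκ : 0 < κ := div_pos (abs_pos.2 (sub_ne_zero.2 hxy)) hC
  have hlim := tendsto_atTop_ciInf hanti ⟨0, by rintro _ ⟨n, rfl⟩; exact Metric.diam_nonneg⟩
  have hbelow : ∀ m, ⨅ n, Metric.diam (J n) ≤ Metric.diam (J m) := hanti.le_of_tendsto hlim
  obtain ⟨N, hN⟩ := eventually_atTop.1
    (hlim.eventually_lt_const (lt_add_of_pos_right _ (half_pos hκ)))
  obtain ⟨n, hNn, hn2, hn⟩ := hfreq N
  have hderiv : ∀ t ∈ Icc (0:ℝ) 1, κ ≤ |deriv (comp Φ.φ ω n) t| := by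
    intro t ht
    obtain ⟨u, hu, hux⟩ := mem_iInter.1 hx n
    obtain ⟨v, hv, hvy⟩ := mem_iInter.1 hy n
    by_contra! hlt
    have hbound : ∀ s ∈ Icc (0:ℝ) 1,
        ‖deriv (comp Φ.φ ω n) s‖ ≤ Φ.distC * |deriv (comp Φ.φ ω n) t| :=
      fun s hs => Φ.distortion ω hω n hn2 hn s hs t ht
    have hmvt := (convex_Icc (0:ℝ) 1).norm_image_sub_le_of_norm_deriv_le
      (fun s _ => differentiable_comp hω n s) hbound hv hu
    rw [hux, hvy, Real.norm_eq_abs, Real.norm_eq_abs] at hmvt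
    have huv : |u - v| ≤ 1 := abs_sub_le_iff.2
      ⟨by linarith [hu.2, hv.1], by linarith [hv.2, hu.1]⟩
    have hle := hmvt.trans (mul_le_of_le_one_right (mul_nonneg hC.le (abs_nonneg _)) huv)
    rw [hκdef, lt_div_iff₀ hC, mul_comm] at hlt
    exact hlt.not_ge hle
  have hω' : (fun j => ω (n + j)) ∈ Φ.Seqs := fun j => hω (n + j)
  have hlong : ∀ m, 1 / 2 < Metric.diam (Φ.φ (ω (n + m)) '' Icc 0 1) := by
    intro m
    refine lt_of_lt_of_le ?_ (diam_image_comp_le hω' m)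
    have hadd := diam_image_add_le (differentiable_comp hω n) hκ hderiv
      (isCompact_image_comp hω' (m + 1)) ((nonempty_Icc.2 zero_le_one).image _)
      (mapsTo_comp hω' (m + 1)).image_subset
    rw [← image_comp, ← comp_add] at hadd
    have h1 := hN n hNn
    have h2 := hbelow (n + (m + 1))
    simp only [hJ] at h1 h2
    by_contra! hle
    have h3 := mul_le_mul_of_nonneg_left hle hκ.le
    linarith
  refine ⟨n, ω n, fun m hm => ?_⟩
  obtain ⟨k, rfl⟩ := Nat.exists_eq_add_of_le hm
  exact eq_of_half_lt_diam (hω _) (hω _) (hlong k) (hlong 0)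

/-- **Lemma.** Every parabolic IFS has decay of fundamental intervals: for every `ω ∈ I^ℕ`
the nested intersection `⋂_{n≥1} φ_{ω₁⋯ω_n}([0,1])` is a singleton. -/
theorem decay_of_fundamental_intervals (Φ : PIFS) (ω : ℕ → ℕ) (hω : ω ∈ Φ.Seqs) :
    ∃ x : ℝ, ⋂ n : ℕ, comp Φ.φ ω (n + 1) '' Icc (0:ℝ) 1 = {x} := by
  have hshift : ⋂ n, comp Φ.φ ω (n + 1) '' Icc (0:ℝ) 1 = ⋂ n, comp Φ.φ ω n '' Icc (0:ℝ) 1 :=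
    (antitone_image_comp hω).iInf_nat_add 1
  rw [hshift, exists_eq_singleton_iff_nonempty_subsingleton]
  refine ⟨nonempty_iInter_image_comp hω, fun x hx y hy => ?_⟩
  by_contra hxy
  obtain ⟨N, i, hN⟩ : ∃ N i, ∀ n, N ≤ n → ω n = i := by
    by_cases hfreq : ∀ N, ∃ n, N ≤ n ∧ 2 ≤ n ∧ (ω (n - 1) ∉ Φ.Par ∨ ω (n - 2) ≠ ω (n - 1))
    · exact eventually_const_of_frequently hω hx hy hxy hfreq
    push Not at hfreq
    obtain ⟨N, hN⟩ := hfreq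
    refine ⟨N, ω N, fun n hn => ?_⟩
    induction n, hn using Nat.le_induction with
    | base => rfl
    | succ n hn ih => exact (hN (n + 2) (by lia) (by lia)).2.symm.trans ih
  exact hxy (subsingleton_iInter_of_eventually_const hω hN hx hy)

end

end ParabolicIFSPaper
end

section
/- With the insertion construction below, for any pair (x,y) of distinct points of L_p(α) with s(x,y) ≥ p, there exist integers k ≥ 0 and m ≥ 0 such that n(k) + mp ≤ s(x,y), n(k) + mp ∈ B_k, and |J(a₁(x),…,a_{n(k)+mp}(x))| ≤ C K⁻¹ |x − y|, where C is the distortion constant of (A2) and K is the minimal distance between distinct fundamental intervals J(ω), J(η) with ω, η ∈ W_p. -/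
open Set MeasureTheory Filter Topology

open scoped ENNReal NNReal Classical

namespace ParabolicIFSPaper

noncomputable section

/-! ### Positions of the blocks and of the inserted digits -/

lemma exists_eq_sum_range_add {m : ℕ → ℕ} (hm : ∀ k, 0 < m k) (t : ℕ) :
    ∃ k j, j < m k ∧ t = ∑ i ∈ Finset.range k, m i + j := by
  induction t with
  | zero => exact ⟨0, 0, hm 0, by simp⟩
  | succ t ih =>
    obtain ⟨k, j, hj, rfl⟩ := ih
    rcases Nat.lt_or_ge (j + 1) (m k) with h | h
    · exact ⟨k, j + 1, h, by ring⟩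
    · exact ⟨k + 1, 0, hm _, by rw [Finset.sum_range_succ]; omega⟩

lemma nseq_eq_sum {p : ℕ} {n m : ℕ → ℕ} (hn0 : n 0 = 0)
    (hn : ∀ k, n (k + 1) = n k + m k * p + 1) (k : ℕ) :
    n k = (∑ i ∈ Finset.range k, m i) * p + k := by
  induction k with
  | zero => simp [hn0]
  | succ k ih => rw [hn, ih, Finset.sum_range_succ]; ring

lemma nseq_strictMono {p : ℕ} {n m : ℕ → ℕ} (hn : ∀ k, n (k + 1) = n k + m k * p + 1) :
    StrictMono n :=
  strictMono_nat_of_lt_succ fun k => by rw [hn]; omega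

lemma exists_eq_nseq_add {p : ℕ} {n m : ℕ → ℕ} (hn0 : n 0 = 0)
    (hn : ∀ k, n (k + 1) = n k + m k * p + 1) (j : ℕ) :
    ∃ k i, i ≤ m k * p ∧ j = n k + i := by
  induction j with
  | zero => exact ⟨0, 0, by simp, by simp [hn0]⟩
  | succ j ih =>
    obtain ⟨k, i, hi, rfl⟩ := ih
    rcases Nat.lt_or_ge i (m k * p) with h | h
    · exact ⟨k, i + 1, h, by ring⟩
    · exact ⟨k + 1, 0, by simp, by rw [hn]; omega⟩

lemma insertSeq_nseq_add {p : ℕ} {n m : ℕ → ℕ} (hn0 : n 0 = 0)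
    (hn : ∀ k, n (k + 1) = n k + m k * p + 1) (α : ℝ) (b : ℕ → ℕ) {k i : ℕ}
    (hi : i < m k * p) :
    insertSeq n α b (n k + i) = b ((∑ j ∈ Finset.range k, m j) * p + i) := by
  have hmono := nseq_strictMono hn
  have hk := hn k
  have hle : ∀ j, n j ≤ n k + i + 1 ↔ j ≤ k := fun j => by
    refine ⟨fun h => ?_, fun h => by have := hmono.monotone h; omega⟩
    by_contra! hj
    have := hmono.monotone (Nat.succ_le_of_lt hj)
    simp only [Nat.succ_eq_add_one] at this
    omega
  have hcnt : cnt n (n k + i + 1) = k := by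
    have : ((Finset.range (n k + i + 1 + 1)).filter fun j => 1 ≤ j ∧ n j ≤ n k + i + 1)
        = Finset.Icc 1 k := by
      ext j
      have := hmono.id_le k
      simp only [id] at this
      simp only [Finset.mem_filter, Finset.mem_range, Finset.mem_Icc, hle]
      omega
    rw [cnt, this, Nat.card_Icc, Nat.add_sub_cancel]
  have hno : ¬ ∃ j, 1 ≤ j ∧ n j = n k + i + 1 := by
    rintro ⟨j, -, hj⟩
    have := hmono.monotone ((hle j).1 hj.le)
    omega
  simp only [insertSeq, if_neg hno, hcnt]
  rw [nseq_eq_sum hn0 hn k]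
  congr 1
  omega

lemma insertSeq_nseq_sub_one {p : ℕ} {n m : ℕ → ℕ}
    (hn : ∀ k, n (k + 1) = n k + m k * p + 1) (α : ℝ) (b : ℕ → ℕ) (k : ℕ) :
    insertSeq n α b (n k + m k * p) = ⌊α * tau (n (k + 1))⌋₊ := by
  rw [insertSeq, if_pos ⟨k + 1, by omega, hn k⟩, hn]
  push_cast
  rfl

lemma insertSeq_congr {p : ℕ} {n m : ℕ → ℕ} (hn0 : n 0 = 0)
    (hn : ∀ k, n (k + 1) = n k + m k * p + 1) (α : ℝ) {b b' : ℕ → ℕ} {k j : ℕ} (hj : j ≤ m k)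
    (hb : ∀ i < (∑ l ∈ Finset.range k, m l + j) * p, b i = b' i) :
    ∀ i < n k + j * p, insertSeq n α b i = insertSeq n α b' i := by
  intro i hi
  obtain ⟨k', i', hi', rfl⟩ := exists_eq_nseq_add hn0 hn i
  rcases hi'.lt_or_eq with h | rfl
  · rw [insertSeq_nseq_add hn0 hn α b h, insertSeq_nseq_add hn0 hn α b' h]
    refine hb _ ?_
    have hjp := Nat.mul_le_mul_right p hj
    rcases lt_trichotomy k' k with hk | rfl | hk
    · have h1 : ∑ l ∈ Finset.range (k' + 1), m l ≤ ∑ l ∈ Finset.range k, m l + j :=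
        (Finset.sum_le_sum_of_subset (by simpa using hk)).trans (Nat.le_add_right _ _)
      have h2 := Nat.mul_le_mul_right p h1
      rw [Finset.sum_range_succ, add_mul] at h2
      omega
    · rw [add_mul]; omega
    · have h1 := (nseq_strictMono hn).monotone (Nat.succ_le_of_lt hk)
      simp only [Nat.succ_eq_add_one, hn] at h1
      omega
  · rw [insertSeq_nseq_sub_one hn, insertSeq_nseq_sub_one hn]

lemma flattenSeq_mul_add {p : ℕ} (σ : ℕ → List ℕ) (t : ℕ) {r : ℕ} (hr : r < p) :
    flattenSeq p σ (t * p + r) = (σ t).getD r 0 := by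
  have hp : 0 < p := by omega
  rw [flattenSeq, mul_comm, Nat.mul_add_div hp, Nat.mul_add_mod, Nat.div_eq_of_lt hr,
    Nat.mod_eq_of_lt hr, add_zero]

/-! ### Compositions along sequences and words -/

lemma comp_congr (φ : ℕ → ℝ → ℝ) {a b : ℕ → ℕ} {N : ℕ} (h : ∀ i < N, a i = b i) :
    comp φ a N = comp φ b N := by
  induction N with
  | zero => rfl
  | succ N ih => simp only [comp, ih fun i hi => h i (by omega), h N (by omega)]

lemma comp_add_length (φ : ℕ → ℝ → ℝ) (a : ℕ → ℕ) (N : ℕ) (w : List ℕ)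
    (h : ∀ r < w.length, a (N + r) = w.getD r 0) :
    comp φ a (N + w.length) = comp φ a N ∘ wcomp φ w := by
  induction w generalizing N with
  | nil => rfl
  | cons c w ih =>
    have h0 := h 0 (by simp)
    have := ih (N + 1) fun r hr => by
      have := h (r + 1) (by simpa using hr)
      simpa [add_assoc, add_comm 1 r] using this
    rw [List.length_cons, add_comm w.length, ← add_assoc, this]
    simp only [add_zero, List.getD_cons_zero] at h0
    simp only [comp, wcomp, h0, Function.comp_assoc]

lemma comp_eq_wcomp (φ : ℕ → ℝ → ℝ) (a : ℕ → ℕ) (N : ℕ) :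
    comp φ a N = wcomp φ ((List.range N).map a) := by
  have := comp_add_length φ a 0 ((List.range N).map a) fun r hr => by
    simp only [List.length_map, List.length_range] at hr
    simp [hr]
  simpa [comp] using this

lemma contDiff_comp (Φ : PIFS) {a : ℕ → ℕ} (ha : a ∈ Φ.Seqs) (N : ℕ) :
    ContDiff ℝ 1 (comp Φ.φ a N) := by
  induction N with
  | zero => exact contDiff_id
  | succ N ih => exact ih.comp (Φ.smooth _ (ha N))

lemma continuous_wcomp (Φ : PIFS) {w : List ℕ} (hw : ∀ a ∈ w, a ∈ Φ.I) :
    Continuous (wcomp Φ.φ w) := by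
  induction w with
  | nil => exact continuous_id
  | cons c w ih =>
    simp only [List.mem_cons, forall_eq_or_imp] at hw
    exact (Φ.smooth _ hw.1).continuous.comp (ih hw.2)

lemma Jset_subset_Icc (Φ : PIFS) {w : List ℕ} (hw : ∀ a ∈ w, a ∈ Φ.I) :
    Jset Φ w ⊆ Icc 0 1 := by
  have : MapsTo (wcomp Φ.φ w) (Icc 0 1) (Icc 0 1) := by
    induction w with
    | nil => exact mapsTo_id _
    | cons c w ih =>
      simp only [List.mem_cons, forall_eq_or_imp] at hw
      exact (Φ.maps_to _ hw.1).comp (ih hw.2)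
  exact this.image_subset

lemma isCompact_Jset (Φ : PIFS) {w : List ℕ} (hw : ∀ a ∈ w, a ∈ Φ.I) :
    IsCompact (Jset Φ w) :=
  isCompact_Icc.image (continuous_wcomp Φ hw)

/-! ### The minimal distance between fundamental intervals -/

lemma Kdist_le (Φ : PIFS) {W : Set (List ℕ)} {w w' : List ℕ} (hw : w ∈ W) (hw' : w' ∈ W)
    (hne : w ≠ w') {u v : ℝ} (hu : u ∈ Jset Φ w) (hv : v ∈ Jset Φ w') :
    Kdist Φ W ≤ |u - v| :=
  csInf_le ⟨0, by rintro _ ⟨w, -, w', -, -, u, -, v, -, rfl⟩; exact abs_nonneg _⟩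
    ⟨w, hw, w', hw', hne, u, hu, v, hv, rfl⟩

lemma Kdist_pos (Φ : PIFS) {W : Finset (List ℕ)} (hW : ∀ w ∈ W, ∀ a ∈ w, a ∈ Φ.I)
    (hdisj : ∀ w ∈ W, ∀ w' ∈ W, w ≠ w' → Jset Φ w ∩ Jset Φ w' = ∅)
    {w w' : List ℕ} (hw : w ∈ W) (hw' : w' ∈ W) (hne : w ≠ w') :
    0 < Kdist Φ (W : Set (List ℕ)) := by
  set D : Set ℝ := ⋃ q ∈ W.offDiag, (fun z : ℝ × ℝ => |z.1 - z.2|) '' (Jset Φ q.1 ×ˢ Jset Φ q.2)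
    with hD
  have hEq : {r | ∃ w ∈ (W : Set (List ℕ)), ∃ w' ∈ (W : Set (List ℕ)), w ≠ w' ∧
      ∃ u ∈ Jset Φ w, ∃ v ∈ Jset Φ w', r = |u - v|} = D := by
    ext r
    simp only [hD, Finset.mem_coe, mem_ofPred_eq, mem_iUnion, mem_image, mem_prod,
      Finset.mem_offDiag, Prod.exists]
    constructor
    · rintro ⟨w, hw, w', hw', hne, u, hu, v, hv, rfl⟩
      exact ⟨w, w', ⟨hw, hw', hne⟩, u, v, ⟨hu, hv⟩, rfl⟩
    · rintro ⟨w, w', ⟨hw, hw', hne⟩, u, v, ⟨hu, hv⟩, rfl⟩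
      exact ⟨w, hw, w', hw', hne, u, hu, v, hv, rfl⟩
  have hcomp : IsCompact D := W.offDiag.isCompact_biUnion fun q hq => by
    rw [Finset.mem_offDiag] at hq
    exact ((isCompact_Jset Φ (hW _ hq.1)).prod (isCompact_Jset Φ (hW _ hq.2.1))).image
      (by fun_prop)
  have hne' : D.Nonempty := by
    rw [← hEq]
    have h0 : (0 : ℝ) ∈ Icc (0 : ℝ) 1 := by simp
    exact ⟨_, w, hw, w', hw', hne, _, mem_image_of_mem _ h0, _, mem_image_of_mem _ h0, rfl⟩
  have hmem := hcomp.sInf_mem hne'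
  rw [Kdist, hEq]
  rw [← hEq] at hmem
  obtain ⟨v, hv, v', hv', hvne, a, ha, b, hb, hab⟩ := hmem
  rw [hEq] at hab
  rw [hab, abs_pos, sub_ne_zero]
  rintro rfl
  exact (hdisj v hv v' hv' hvne).subset ⟨ha, hb⟩

/-! ### Bounded distortion and the diameter of an image -/

lemma exists_abs_sub_eq_abs_deriv_mul {f : ℝ → ℝ} (hf : Differentiable ℝ f) {s : Set ℝ}
    (hs : s.OrdConnected) {u v : ℝ} (hu : u ∈ s) (hv : v ∈ s) :
    ∃ ξ ∈ s, |f u - f v| = |deriv f ξ| * |u - v| := by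
  wlog huv : u ≤ v generalizing u v
  · obtain ⟨ξ, hξ, h⟩ := this hv hu (le_of_not_ge huv)
    exact ⟨ξ, hξ, by rw [abs_sub_comm, h, abs_sub_comm v]⟩
  rcases huv.eq_or_lt with rfl | huv
  · exact ⟨u, hu, by simp⟩
  obtain ⟨ξ, hξ, h⟩ := exists_deriv_eq_slope f huv hf.continuous.continuousOn
    hf.differentiableOn
  refine ⟨ξ, hs.out hu hv (Ioo_subset_Icc_self hξ), ?_⟩
  rw [abs_sub_comm, abs_sub_comm u, ← abs_mul, h, div_mul_cancel₀ _ (sub_ne_zero.2 huv.ne')]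

lemma diam_image_Icc_le_of_distortion {f : ℝ → ℝ} (hf : Differentiable ℝ f) {C K : ℝ}
    (hC : 0 ≤ C) (hK : 0 < K)
    (hdist : ∀ x ∈ Icc (0 : ℝ) 1, ∀ y ∈ Icc (0 : ℝ) 1, |deriv f x| ≤ C * |deriv f y|)
    {u v : ℝ} (hu : u ∈ Icc (0 : ℝ) 1) (hv : v ∈ Icc (0 : ℝ) 1) (huv : K ≤ |u - v|) :
    Metric.diam (f '' Icc (0 : ℝ) 1) ≤ C * K⁻¹ * |f u - f v| := by
  obtain ⟨ξ, hξ, hfξ⟩ := exists_abs_sub_eq_abs_deriv_mul hf ordConnected_Icc hu hv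
  refine Metric.diam_le_of_forall_dist_le (by positivity) ?_
  rintro _ ⟨a, ha, rfl⟩ _ ⟨b, hb, rfl⟩
  obtain ⟨η, hη, hfη⟩ := exists_abs_sub_eq_abs_deriv_mul hf ordConnected_Icc ha hb
  have hab : |a - b| ≤ 1 := by
    rw [abs_le]; constructor <;> linarith [ha.1, ha.2, hb.1, hb.2]
  calc dist (f a) (f b) = |deriv f η| * |a - b| := by rw [Real.dist_eq, hfη]
    _ ≤ |deriv f η| * 1 := by gcongr
    _ ≤ C * |deriv f ξ| := by rw [mul_one]; exact hdist _ hη _ hξ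
    _ = C * K⁻¹ * (|deriv f ξ| * K) := by field_simp
    _ ≤ C * K⁻¹ * |f u - f v| := by rw [hfξ]; gcongr

/-! ### The insertion construction -/

namespace InsSetup

variable {Φ : PIFS} {Pi : (ℕ → ℕ) → ℝ} (S : InsSetup Φ Pi)

/-- The digit sequence of the point of `L_p(α)` with blocks `σ`. -/
abbrev digits (σ : ℕ → List ℕ) : ℕ → ℕ := insertSeq S.nseq S.α (flattenSeq S.p σ)

lemma length_eq {w : List ℕ} (hw : w ∈ S.W) : w.length = S.p := (S.hWsub hw).1

lemma mem_I {w : List ℕ} (hw : w ∈ S.W) : ∀ a ∈ w, a ∈ Φ.I := (S.hWsub hw).2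

lemma p_pos : 0 < S.p := by have := S.hp2; omega

lemma flattenSeq_mem {σ : ℕ → List ℕ} (hσ : ∀ k, σ k ∈ S.W) (i : ℕ) :
    flattenSeq S.p σ i ∈ Φ.I := by
  have h : i % S.p < (σ (i / S.p)).length := by
    rw [S.length_eq (hσ _)]; exact Nat.mod_lt _ S.p_pos
  rw [flattenSeq, List.getD_eq_getElem _ _ h]
  exact S.mem_I (hσ _) _ (List.getElem_mem h)

lemma digits_mem_seqs {σ : ℕ → List ℕ} (hσ : ∀ k, σ k ∈ S.W) : S.digits σ ∈ Φ.Seqs := by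
  intro i
  unfold digits insertSeq
  split_ifs with h
  · obtain ⟨k, hk, hki⟩ := h
    have := S.hins k hk
    rw [hki] at this
    exact_mod_cast this
  · exact S.flattenSeq_mem hσ _

lemma digits_block (σ : ℕ → List ℕ) {k j r : ℕ} (hj : j < S.mseq k) (hr : r < S.p) :
    S.digits σ (S.nseq k + j * S.p + r) =
      (σ (∑ i ∈ Finset.range k, S.mseq i + j)).getD r 0 := by
  have : j * S.p + r < S.mseq k * S.p := by
    have := Nat.mul_le_mul_right S.p (Nat.succ_le_of_lt hj)
    rw [Nat.succ_mul] at this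
    omega
  rw [digits, add_assoc, insertSeq_nseq_add S.hn0 S.hnrec _ _ this, ← add_assoc, ← add_mul,
    flattenSeq_mul_add σ _ hr]

lemma digits_block_last_notMem_Par {σ : ℕ → List ℕ} (hσ : ∀ k, σ k ∈ S.W) {k j : ℕ}
    (hj : j < S.mseq k) : S.digits σ (S.nseq k + j * S.p + (S.p - 1)) ∉ Φ.Par := by
  have hp := S.p_pos
  rw [S.digits_block σ hj (by omega)]
  set w := σ (∑ i ∈ Finset.range k, S.mseq i + j)
  have hw : w ∈ S.W := hσ _
  have hlen := S.length_eq hw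
  have hne : w ≠ [] := by rintro h; simp [h] at hlen; omega
  have := S.hWlast w hw hne
  rwa [List.getLast_eq_getElem, ← List.getD_eq_getElem _ 0, hlen] at this

lemma abs_deriv_comp_digits_le {σ : ℕ → List ℕ} (hσ : ∀ k, σ k ∈ S.W) {k j : ℕ}
    (hj : j ≤ S.mseq k) {x y : ℝ} (hx : x ∈ Icc (0 : ℝ) 1) (hy : y ∈ Icc (0 : ℝ) 1) :
    |deriv (comp Φ.φ (S.digits σ) (S.nseq k + j * S.p)) x| ≤
      Φ.distC * |deriv (comp Φ.φ (S.digits σ) (S.nseq k + j * S.p)) y| := by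
  have hp := S.hp2
  rcases j with _ | j
  · rcases k with _ | k
    · simpa [S.hn0, comp] using Φ.distC_ge_one
    · obtain ⟨l, hl⟩ : ∃ l, S.mseq k = l + 1 := ⟨_, (Nat.succ_pred_eq_of_pos
        (by have := S.hm2 k; omega)).symm⟩
      have hlast := S.digits_block_last_notMem_Par hσ (k := k) (j := l) (by omega)
      have hN : S.nseq (k + 1) = S.nseq k + l * S.p + (S.p - 1) + 2 := by
        rw [S.hnrec, hl, add_mul]; omega
      refine Φ.distortion _ (S.digits_mem_seqs hσ) _ (by omega) ?_ x hx y hy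
      rw [zero_mul, add_zero, hN]
      by_contra! h
      exact hlast (by simpa using h.2 ▸ h.1)
  · refine Φ.distortion _ (S.digits_mem_seqs hσ) _ (by rw [add_mul]; omega) (Or.inl ?_) x hx y hy
    have : S.nseq k + (j + 1) * S.p - 1 = S.nseq k + j * S.p + (S.p - 1) := by
      rw [add_mul]; omega
    rw [this]
    exact S.digits_block_last_notMem_Par hσ hj

lemma exists_mem_Jset_comp_eq {σ : ℕ → List ℕ} (hσ : ∀ k, σ k ∈ S.W) {k j : ℕ}
    (hj : j < S.mseq k) :
    ∃ u ∈ Jset Φ (σ (∑ i ∈ Finset.range k, S.mseq i + j)),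
      comp Φ.φ (S.digits σ) (S.nseq k + j * S.p) u = Pi (S.digits σ) := by
  set w := σ (∑ i ∈ Finset.range k, S.mseq i + j)
  have hlen : w.length = S.p := S.length_eq (hσ _)
  obtain ⟨z, hz, h⟩ := S.hPi _ (S.digits_mem_seqs hσ) (S.nseq k + j * S.p + w.length)
  rw [comp_add_length _ _ _ _ fun r hr => S.digits_block σ hj (hlen ▸ hr)] at h
  exact ⟨_, mem_image_of_mem _ hz, h⟩

lemma digits_congr {σ σ' : ℕ → List ℕ} {k j : ℕ} (hj : j ≤ S.mseq k)
    (h : ∀ t < ∑ i ∈ Finset.range k, S.mseq i + j, σ t = σ' t) :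
    ∀ i < S.nseq k + j * S.p, S.digits σ i = S.digits σ' i :=
  insertSeq_congr S.hn0 S.hnrec S.α hj fun i hi => by
    rw [flattenSeq, flattenSeq, h _ (Nat.div_lt_of_lt_mul (by rwa [mul_comm]))]

end InsSetup

lemma Pi_mem_Jset_of_congr {Φ : PIFS} {Pi : (ℕ → ℕ) → ℝ} (hPi : IsAddressMap Φ Pi)
    {a b : ℕ → ℕ} (hb : b ∈ Φ.Seqs) {N : ℕ} (h : ∀ i < N, a i = b i) :
    Pi b ∈ Jset Φ ((List.range N).map a) := by
  rw [Jset, ← comp_eq_wcomp, comp_congr _ h]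
  exact hPi b hb N

/-- **Lemma (second technical lemma).** For distinct `x, y ∈ L_p(α)` with `s(x,y) ≥ p`
there are `k, m ≥ 0` with `n(k) + mp ≤ s(x,y)`, `n(k) + mp ∈ B_k` and
`|J(a₁(x),…,a_{n(k)+mp}(x))| ≤ C K⁻¹ |x - y|`. -/
theorem separation_lemma (Φ : PIFS) (Pi : (ℕ → ℕ) → ℝ) (S : InsSetup Φ Pi)
    (x y : ℝ) (σx : ℕ → List ℕ) (hσx : ∀ k, σx k ∈ S.W)
    (hx : x = Pi (insertSeq S.nseq S.α (flattenSeq S.p σx)))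
    (hy : y ∈ LpSet Φ Pi (↑S.W : Set (List ℕ)) S.p S.nseq S.α) (hxy : x ≠ y)
    (s : ℕ) (hsp : S.p ≤ s)
    (hs1 : ∃ l ∈ Words Φ s, x ∈ Jset Φ l ∧ y ∈ Jset Φ l)
    (hs2 : ∀ l ∈ Words Φ (s + 1), ¬(x ∈ Jset Φ l ∧ y ∈ Jset Φ l)) :
    ∃ k m : ℕ, S.nseq k + m * S.p ≤ s ∧
      S.nseq k + m * S.p ∈ Bset S.nseq S.mseq S.p k ∧
      Metric.diam (comp Φ.φ (insertSeq S.nseq S.α (flattenSeq S.p σx))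
          (S.nseq k + m * S.p) '' Icc (0:ℝ) 1) ≤
        Φ.distC * (Kdist Φ (↑S.W : Set (List ℕ)))⁻¹ * |x - y| := by
  obtain ⟨σy, hσy, rfl⟩ := hy
  subst hx
  have hσ : ∃ t, σx t ≠ σy t := by
    by_contra! h
    exact hxy (by rw [funext h])
  obtain ⟨k, m, hm, ht⟩ := exists_eq_sum_range_add
    (fun k => lt_of_lt_of_le two_pos (S.hm2 k)) (Nat.find hσ)
  have hne := Nat.find_spec hσ
  rw [ht] at hne
  have hagree : ∀ i < S.nseq k + m * S.p, S.digits σx i = S.digits σy i :=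
    S.digits_congr hm.le fun t h => not_not.1 (Nat.find_min hσ (ht ▸ h))
  have hxI := S.digits_mem_seqs hσx
  refine ⟨k, m, ?_, ⟨m, hm.le, rfl⟩, ?_⟩
  · by_contra! hs
    refine hs2 ((List.range (s + 1)).map (S.digits σx)) ⟨by simp, ?_⟩
      ⟨Pi_mem_Jset_of_congr S.hPi hxI fun _ _ => rfl,
        Pi_mem_Jset_of_congr S.hPi (S.digits_mem_seqs hσy) fun i hi => hagree i (by omega)⟩
    simp only [List.mem_map]
    rintro _ ⟨i, -, rfl⟩
    exact hxI i
  · obtain ⟨u, hu, hxu⟩ := S.exists_mem_Jset_comp_eq hσx hm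
    obtain ⟨v, hv, hyv⟩ := S.exists_mem_Jset_comp_eq hσy hm
    rw [← comp_congr _ hagree] at hyv
    rw [← hxu, ← hyv]
    exact diam_image_Icc_le_of_distortion ((contDiff_comp Φ hxI _).differentiable (by simp))
      (zero_le_one.trans Φ.distC_ge_one)
      (Kdist_pos Φ (fun w hw => S.mem_I hw) S.hWdisj (hσx _) (hσy _) hne)
      (fun _ h _ h' => S.abs_deriv_comp_digits_le hσx hm.le h h')
      (Jset_subset_Icc Φ (S.mem_I (hσx _)) hu) (Jset_subset_Icc Φ (S.mem_I (hσy _)) hv)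
      (Kdist_le Φ (hσx _) (hσy _) hne hu hv)

end

end ParabolicIFSPaper
end
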